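/- Let N ≥ 1, let Ω ⊆ ℝ^N be open with nonempty complement, let m ≥ 1 be an integer, let p ≥ 1 and let s ∈ ℝ. If u is a smooth function on Ω (more generally, u ∈ W^{m,p}_loc(Ω)) such that ∫_Ω |u(x)|^p d(x)^{−mp+s} dx < ∞ and ∫_Ω ‖∇^m u(x)‖^p d(x)^s dx < ∞, then u ∈ W_0^{m,p}(Ω, d^s), i.e. u is the limit in L^p(Ω, d(x)^s dx) of a sequence of functions in C_c^∞(Ω) that is Cauchy in the weighted Sobolev norm ‖·‖_{W^{m,p}(Ω,d^s)}. -/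

import Mathlib

open MeasureTheory Filter

noncomputable section

/-- Euclidean space `ℝ^N`. -/
abbrev Euc (N : ℕ) := EuclideanSpace ℝ (Fin N)

/-- `d(x) = dist(x, ℝ^N \ Ω)`, the distance to the complement of `Ω`. -/
def dw {N : ℕ} (Ω : Set (Euc N)) (x : Euc N) : ℝ := Metric.infDist x Ωᶜ

/-- A test function: smooth with compact support contained in `Ω`. -/
def IsTestFun {N : ℕ} (Ω : Set (Euc N)) (φ : Euc N → ℝ) : Prop :=
  ContDiff ℝ (⊤ : ℕ∞) φ ∧ HasCompactSupport φ ∧ tsupport φ ⊆ Ω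

/-- The weighted Sobolev norm
`‖u‖_{W^{m,p}(Ω, d^s)} = ∑_{k=0}^m (∫_Ω ‖∇^k u‖^p d(x)^s dx)^{1/p}`. -/
def sobNorm {N : ℕ} (Ω : Set (Euc N)) (m : ℕ) (p s : ℝ) (u : Euc N → ℝ) : ℝ :=
  ∑ k ∈ Finset.range (m + 1),
    (∫ x in Ω, ‖iteratedFDeriv ℝ k u x‖ ^ p * dw Ω x ^ s) ^ (1 / p)

/-- `φ` is a sequence of test functions, Cauchy in the weighted Sobolev norm,
converging to `u` in `L^p(Ω, d^s dx)`. -/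
def IsApproxSeq {N : ℕ} (Ω : Set (Euc N)) (m : ℕ) (p s : ℝ)
    (u : Euc N → ℝ) (φ : ℕ → Euc N → ℝ) : Prop :=
  (∀ j, IsTestFun Ω (φ j)) ∧
  (∀ ε > 0, ∃ J, ∀ j ≥ J, ∀ k ≥ J, sobNorm Ω m p s (φ j - φ k) < ε) ∧
  Tendsto (fun j => ∫ x in Ω, |φ j x - u x| ^ p * dw Ω x ^ s) atTop (nhds 0)

/-- Membership in `W_0^{m,p}(Ω, d^s)`. -/
def MemW0 {N : ℕ} (Ω : Set (Euc N)) (m : ℕ) (p s : ℝ) (u : Euc N → ℝ) : Prop :=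
  ∃ φ, IsApproxSeq Ω m p s u φ

/-- The norm on `W_0^{m,p}(Ω, d^s)`: infimum over approximating sequences of the
limit of the weighted Sobolev norms. -/
def W0Norm {N : ℕ} (Ω : Set (Euc N)) (m : ℕ) (p s : ℝ) (u : Euc N → ℝ) : ℝ :=
  sInf {L | ∃ φ, IsApproxSeq Ω m p s u φ ∧
    Tendsto (fun j => sobNorm Ω m p s (φ j)) atTop (nhds L)}

/-- The truncated distance `min 1 d` to the complement of `Ω`. -/
def truncDist {N : ℕ} (Ω : Set (Euc N)) (x : Euc N) : ℝ := min 1 (dw Ω x)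

/-- The point at distance `σ * truncDist Ω x / 2` from `x` in the direction `e`. -/
def shift {N : ℕ} (Ω : Set (Euc N)) (e : Euc N) (σ : ℝ) (x : Euc N) : Euc N :=
  x + (σ * (truncDist Ω x / 2)) • e

section Distance

variable {N : ℕ} {Ω : Set (Euc N)}

lemma dw_pos (hΩ : IsOpen Ω) (hc : Ωᶜ.Nonempty) {x : Euc N} (hx : x ∈ Ω) : 0 < dw Ω x :=
  (hΩ.isClosed_compl.notMem_iff_infDist_pos hc).1 (by simpa using hx)

lemma mem_of_dw_pos {x : Euc N} (hx : 0 < dw Ω x) : x ∈ Ω := by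
  by_contra h
  have : dw Ω x = 0 := Metric.infDist_zero_of_mem (Set.mem_compl h)
  linarith

lemma truncDist_pos (hΩ : IsOpen Ω) (hc : Ωᶜ.Nonempty) {x : Euc N} (hx : x ∈ Ω) :
    0 < truncDist Ω x :=
  lt_min one_pos (dw_pos hΩ hc hx)

lemma truncDist_nonneg (x : Euc N) : 0 ≤ truncDist Ω x :=
  le_min zero_le_one Metric.infDist_nonneg

lemma continuous_dw : Continuous (dw Ω) := Metric.continuous_infDist_pt _

lemma continuous_truncDist : Continuous (truncDist Ω) := continuous_const.min continuous_dw

lemma dw_le_add (x y : Euc N) : dw Ω x ≤ dw Ω y + dist x y :=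
  Metric.infDist_le_infDist_add_dist

lemma truncDist_le_add (x y : Euc N) : truncDist Ω x ≤ truncDist Ω y + dist x y := by
  have := dw_le_add (Ω := Ω) x y
  have h0 : 0 ≤ dist x y := dist_nonneg
  unfold truncDist
  rcases min_cases 1 (dw Ω y) with ⟨h, _⟩ | ⟨h, _⟩ <;> rw [h]
  · exact (min_le_left _ _).trans (by linarith)
  · exact (min_le_right _ _).trans this

lemma dist_shift_le {e : Euc N} (he : ‖e‖ ≤ 1) {σ : ℝ} (hσ : σ ∈ Set.Icc (0 : ℝ) 1)
    (x : Euc N) : dist (shift Ω e σ x) x ≤ truncDist Ω x / 2 := by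
  have hr := truncDist_nonneg (Ω := Ω) x
  have h1 : 0 ≤ σ * (truncDist Ω x / 2) := mul_nonneg hσ.1 (by linarith)
  rw [shift, dist_eq_norm, add_sub_cancel_left, norm_smul, Real.norm_of_nonneg h1]
  calc _ ≤ 1 * (truncDist Ω x / 2) * 1 := by
        gcongr
        exact hσ.2
    _ = _ := by ring

lemma dw_shift_bounds {e : Euc N} (he : ‖e‖ ≤ 1) {σ : ℝ} (hσ : σ ∈ Set.Icc (0 : ℝ) 1)
    (x : Euc N) : dw Ω x ≤ 2 * dw Ω (shift Ω e σ x) ∧ dw Ω (shift Ω e σ x) ≤ 2 * dw Ω x := by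
  have h := dist_shift_le (Ω := Ω) he hσ x
  have h1 : truncDist Ω x ≤ dw Ω x := min_le_right _ _
  have h2 := dw_le_add (Ω := Ω) x (shift Ω e σ x)
  have h3 := dw_le_add (Ω := Ω) (shift Ω e σ x) x
  have h0 : 0 ≤ dw Ω x := Metric.infDist_nonneg
  rw [dist_comm] at h2
  constructor <;> linarith

lemma truncDist_shift_bounds {e : Euc N} (he : ‖e‖ ≤ 1) {σ : ℝ} (hσ : σ ∈ Set.Icc (0 : ℝ) 1)
    (x : Euc N) : truncDist Ω x ≤ 2 * truncDist Ω (shift Ω e σ x) ∧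
      truncDist Ω (shift Ω e σ x) ≤ 2 * truncDist Ω x := by
  have h := dist_shift_le (Ω := Ω) he hσ x
  have h2 := truncDist_le_add (Ω := Ω) x (shift Ω e σ x)
  have h3 := truncDist_le_add (Ω := Ω) (shift Ω e σ x) x
  have h0 := truncDist_nonneg (Ω := Ω) x
  rw [dist_comm] at h2
  constructor <;> linarith

lemma shift_mem (hΩ : IsOpen Ω) (hc : Ωᶜ.Nonempty) {e : Euc N} (he : ‖e‖ ≤ 1) {σ : ℝ}
    (hσ : σ ∈ Set.Icc (0 : ℝ) 1) {x : Euc N} (hx : x ∈ Ω) : shift Ω e σ x ∈ Ω := by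
  have := (dw_shift_bounds (Ω := Ω) he hσ x).1
  have := dw_pos hΩ hc hx
  exact mem_of_dw_pos (by linarith)

lemma antilipschitzWith_shift {e : Euc N} (he : ‖e‖ ≤ 1) {σ : ℝ}
    (hσ : σ ∈ Set.Icc (0 : ℝ) 1) : AntilipschitzWith 2 (shift Ω e σ) := by
  refine AntilipschitzWith.of_le_mul_dist fun x y => ?_
  have h1 := truncDist_le_add (Ω := Ω) x y
  have h2 := truncDist_le_add (Ω := Ω) y x
  rw [dist_comm y x] at h2
  have h3 : |truncDist Ω x - truncDist Ω y| ≤ dist x y := abs_le.2 ⟨by linarith, by linarith⟩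
  have h4 : ‖(σ * ((truncDist Ω x - truncDist Ω y) / 2)) • e‖ ≤ dist x y / 2 := by
    rw [norm_smul, Real.norm_eq_abs, abs_mul, abs_div, abs_of_nonneg hσ.1, abs_two]
    calc _ ≤ 1 * (dist x y / 2) * 1 := by
          gcongr
          exact hσ.2
      _ = _ := by ring
  have h5 : x - y = (shift Ω e σ x - shift Ω e σ y)
      - (σ * ((truncDist Ω x - truncDist Ω y) / 2)) • e := by
    simp only [shift, sub_div, mul_sub, sub_smul]
    abel
  have h6 : dist x y ≤ dist (shift Ω e σ x) (shift Ω e σ y) + dist x y / 2 := by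
    conv_lhs => rw [dist_eq_norm, h5]
    refine (norm_sub_le _ _).trans ?_
    rw [← dist_eq_norm]
    gcongr
  simp only [NNReal.coe_ofNat]
  linarith

lemma continuous_shift (e : Euc N) :
    Continuous (fun q : Euc N × ℝ => shift Ω e q.2 q.1) := by
  unfold shift
  have := continuous_truncDist (Ω := Ω)
  fun_prop

end Distance

section ChangeOfVariables

variable {N : ℕ} {Ω : Set (Euc N)}

lemma volume_preimage_le_of_antilipschitz {T : Euc N → Euc N} {K : NNReal}
    (hT : AntilipschitzWith K T) (A : Set (Euc N)) :
    volume (T ⁻¹' A) ≤ (K : ENNReal) ^ (N : ℝ) * volume A := by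
  have hH : (Measure.hausdorffMeasure (N : ℝ) : Measure (Euc N)).IsAddHaarMeasure := by
    simpa using isAddHaarMeasure_hausdorffMeasure (E := Euc N)
  have h := Measure.isAddLeftInvariant_eq_smul (volume : Measure (Euc N))
    (Measure.hausdorffMeasure (N : ℝ))
  rw [h, Measure.smul_apply, Measure.smul_apply, mul_smul_comm]
  gcongr
  exact hT.hausdorffMeasure_preimage_le N.cast_nonneg A

lemma volume_restrict_preimage_shift_le (hΩ : IsOpen Ω) (hc : Ωᶜ.Nonempty) {e : Euc N}
    (he : ‖e‖ ≤ 1) {σ : ℝ} (hσ : σ ∈ Set.Icc (0 : ℝ) 1) (A : Set (Euc N)) :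
    volume.restrict Ω (shift Ω e σ ⁻¹' A) ≤ (2 : ENNReal) ^ (N : ℝ) * volume.restrict Ω A := by
  rw [Measure.restrict_apply' hΩ.measurableSet, Measure.restrict_apply' hΩ.measurableSet]
  refine le_trans (measure_mono ?_)
    (volume_preimage_le_of_antilipschitz (antilipschitzWith_shift (Ω := Ω) he hσ) (A ∩ Ω))
  exact fun x hx => ⟨hx.1, shift_mem hΩ hc he hσ hx.2⟩

lemma measurable_shift (e : Euc N) (σ : ℝ) : Measurable (shift Ω e σ) :=
  ((continuous_shift (Ω := Ω) e).comp (Continuous.prodMk_left σ)).measurable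

lemma integrableOn_comp_shift (hΩ : IsOpen Ω) (hc : Ωᶜ.Nonempty) {e : Euc N}
    (he : ‖e‖ ≤ 1) {σ : ℝ} (hσ : σ ∈ Set.Icc (0 : ℝ) 1) {G : Euc N → ℝ}
    (hG : IntegrableOn G Ω) : IntegrableOn (fun x => G (shift Ω e σ x)) Ω := by
  have hle : (volume.restrict Ω).map (shift Ω e σ)
      ≤ ((2 : ENNReal) ^ (N : ℝ)) • volume.restrict Ω := by
    refine Measure.le_iff.2 fun A hA => ?_
    rw [Measure.map_apply (measurable_shift e σ) hA]
    exact volume_restrict_preimage_shift_le hΩ hc he hσ A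
  have h := (hG.smul_measure (c := (2 : ENNReal) ^ (N : ℝ)) (by simp)).mono_measure hle
  exact h.comp_measurable (measurable_shift e σ)

lemma integrableOn_integral_comp_shift (hΩ : IsOpen Ω) (hc : Ωᶜ.Nonempty) {e : Euc N}
    (he : ‖e‖ ≤ 1) {G : Euc N → ℝ} (hG : IntegrableOn G Ω) :
    IntegrableOn (fun x => ∫ σ in (0 : ℝ)..1, G (shift Ω e σ x)) Ω := by
  set ν : Measure ℝ := volume.restrict (Set.Ioc 0 1)
  have hS : Measurable (fun q : Euc N × ℝ => shift Ω e q.2 q.1) :=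
    (continuous_shift e).measurable
  have hle : ((volume.restrict Ω).prod ν).map (fun q : Euc N × ℝ => shift Ω e q.2 q.1)
      ≤ ((2 : ENNReal) ^ (N : ℝ)) • volume.restrict Ω := by
    refine Measure.le_iff.2 fun A hA => ?_
    rw [Measure.map_apply hS hA, Measure.prod_apply_symm (hS hA)]
    calc _ ≤ ∫⁻ _, (2 : ENNReal) ^ (N : ℝ) * volume.restrict Ω A ∂ν := by
          refine setLIntegral_mono' measurableSet_Ioc fun σ hσ => ?_
          exact volume_restrict_preimage_shift_le hΩ hc he ⟨hσ.1.le, hσ.2⟩ A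
      _ = _ := by simp [ν]
  have h := ((hG.smul_measure (c := (2 : ENNReal) ^ (N : ℝ)) (by simp)).mono_measure
    hle).comp_measurable hS
  simp only [intervalIntegral.integral_of_le zero_le_one]
  exact h.integral_prod_left

end ChangeOfVariables

section Taylor

variable {F : Type*} [NormedAddCommGroup F] [NormedSpace ℝ F] [CompleteSpace F]

lemma norm_sub_taylor_le (m : ℕ) (g : ℕ → ℝ → F)
    (hg : ∀ i ≤ m, ∀ t ∈ Set.Icc (0 : ℝ) 1, HasDerivAt (g i) (g (i + 1) t) t)
    (hcont : ContinuousOn (g (m + 1)) (Set.Icc 0 1)) {t : ℝ} (ht : t ∈ Set.Icc (0 : ℝ) 1) :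
    ‖g 0 t - ∑ i ∈ Finset.range (m + 1), (t ^ i / (i.factorial : ℝ)) • g i 0‖
      ≤ ∫ σ in (0 : ℝ)..1, ‖g (m + 1) σ‖ := by
  induction m generalizing g t with
  | zero =>
    have hsub : Set.uIcc 0 t ⊆ Set.Icc (0 : ℝ) 1 := by
      rw [Set.uIcc_of_le ht.1]
      exact Set.Icc_subset_Icc_right ht.2
    have hint : IntervalIntegrable (g (0 + 1)) volume 0 t :=
      (hcont.mono hsub).intervalIntegrable
    have h := intervalIntegral.integral_eq_sub_of_hasDerivAt
      (fun x hx => hg 0 le_rfl x (hsub hx)) hint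
    simp only [zero_add, Finset.range_one, Finset.sum_singleton, pow_zero, Nat.factorial_zero,
      Nat.cast_one, div_one, one_smul]
    rw [← h]
    refine (intervalIntegral.norm_integral_le_integral_norm ht.1).trans ?_
    refine intervalIntegral.integral_mono_interval le_rfl ht.1 ht.2
      (Eventually.of_forall fun _ => norm_nonneg _) ?_
    refine ContinuousOn.intervalIntegrable ?_
    rw [Set.uIcc_of_le zero_le_one]
    exact hcont.norm
  | succ m ih =>
    set K := ∫ σ in (0 : ℝ)..1, ‖g (m + 1 + 1) σ‖
    have hK : 0 ≤ K := intervalIntegral.integral_nonneg zero_le_one fun _ _ => norm_nonneg _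
    have key : ∀ x ∈ Set.Icc (0 : ℝ) 1,
        ‖g 1 x - ∑ i ∈ Finset.range (m + 1), (x ^ i / (i.factorial : ℝ)) • g (i + 1) 0‖ ≤ K :=
      fun x hx => ih (fun i => g (i + 1)) (fun i hi => hg (i + 1) (by omega)) hcont hx
    have hder : ∀ x ∈ Set.Icc (0 : ℝ) 1, HasDerivAt
        (fun t => g 0 t - ∑ i ∈ Finset.range (m + 1 + 1), (t ^ i / (i.factorial : ℝ)) • g i 0)
        (g 1 x - ∑ i ∈ Finset.range (m + 1), (x ^ i / (i.factorial : ℝ)) • g (i + 1) 0) x := by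
      intro x hx
      simp only [Finset.sum_range_succ' _ (m + 1)]
      refine (hg 0 (Nat.zero_le _) x hx).sub ?_
      simp only [pow_zero, Nat.factorial_zero, Nat.cast_one, div_one, one_smul]
      refine HasDerivAt.add_const _ (HasDerivAt.fun_sum fun i _ => ?_)
      have h1 := ((hasDerivAt_pow (i + 1) x).div_const ((i + 1).factorial : ℝ)).smul_const
        (g (i + 1) 0)
      convert h1 using 2
      rw [Nat.factorial_succ]
      push_cast
      have : (i.factorial : ℝ) ≠ 0 := by positivity
      have : (i : ℝ) + 1 ≠ 0 := by positivity
      field_simp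
    have h := (convex_Icc (0 : ℝ) 1).norm_image_sub_le_of_norm_hasDerivWithin_le
      (fun x hx => (hder x hx).hasDerivWithinAt) key (Set.left_mem_Icc.2 zero_le_one) ht
    have h0 : g 0 0 - ∑ i ∈ Finset.range (m + 1 + 1),
        ((0 : ℝ) ^ i / (i.factorial : ℝ)) • g i 0 = 0 := by
      simp [Finset.sum_range_succ' _ (m + 1)]
    rw [h0, sub_zero, sub_zero, Real.norm_of_nonneg ht.1] at h
    exact h.trans (mul_le_of_le_one_right hK ht.2)

lemma exists_nodes (m : ℕ) : ∃ c t : Fin (m + 2) → ℝ, (∀ j, t j ∈ Set.Icc (0 : ℝ) 1) ∧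
    ∀ i < m + 2, ∑ j, c j * t j ^ i = if i = 1 then 1 else 0 := by
  set t : Fin (m + 2) → ℝ := fun j => (j : ℝ) / (m + 2)
  have hm : (0 : ℝ) < m + 2 := by positivity
  have ht : Function.Injective t := by
    intro a b h
    have h' : (a : ℝ) = b := by
      simpa [t, div_left_inj' hm.ne'] using h
    exact Fin.ext (by exact_mod_cast h')
  have hdet : IsUnit (Matrix.vandermonde t).det :=
    (Matrix.det_vandermonde_ne_zero_iff.2 ht).isUnit
  set V := Matrix.vandermonde t
  set b : Fin (m + 2) → ℝ := fun i => if (i : ℕ) = 1 then 1 else 0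
  refine ⟨Matrix.vecMul b V⁻¹, t, fun j => ⟨by positivity, ?_⟩, fun i hi => ?_⟩
  · rw [div_le_one hm]
    exact_mod_cast j.2.le
  · have h : Matrix.vecMul (Matrix.vecMul b V⁻¹) V = b := by
      rw [Matrix.vecMul_vecMul, Matrix.nonsing_inv_mul _ hdet, Matrix.vecMul_one]
    have := congrFun h ⟨i, hi⟩
    simpa [Matrix.vecMul, dotProduct, V, Matrix.vandermonde_apply, b] using this

lemma exists_norm_deriv_le (m : ℕ) : ∃ (C : ℝ) (t : Fin (m + 2) → ℝ), 0 ≤ C ∧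
    (∀ j, t j ∈ Set.Icc (0 : ℝ) 1) ∧ ∀ g : ℕ → ℝ → F,
    (∀ i ≤ m + 1, ∀ t ∈ Set.Icc (0 : ℝ) 1, HasDerivAt (g i) (g (i + 1) t) t) →
    ContinuousOn (g (m + 2)) (Set.Icc 0 1) →
    ‖g 1 0‖ ≤ C * (∑ j, ‖g 0 (t j)‖ + ∫ σ in (0 : ℝ)..1, ‖g (m + 2) σ‖) := by
  obtain ⟨c, t, ht, hct⟩ := exists_nodes m
  refine ⟨∑ j, |c j|, t, Finset.sum_nonneg fun _ _ => abs_nonneg _, ht, fun g hg hcont => ?_⟩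
  set K := ∫ σ in (0 : ℝ)..1, ‖g (m + 2) σ‖
  set P : ℝ → F := fun t => ∑ i ∈ Finset.range (m + 2), (t ^ i / (i.factorial : ℝ)) • g i 0
  have hP : ∑ j, c j • P (t j) = g 1 0 := by
    simp only [P, Finset.smul_sum, smul_smul]
    rw [Finset.sum_comm]
    have : ∀ i ∈ Finset.range (m + 2), ∑ j, (c j * (t j ^ i / (i.factorial : ℝ))) • g i 0
        = if i = 1 then g 1 0 else 0 := by
      intro i hi
      rw [← Finset.sum_smul]
      simp only [← mul_div_assoc]
      rw [← Finset.sum_div, hct i (Finset.mem_range.1 hi)]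
      split_ifs with h
      · simp [h]
      · simp
    rw [Finset.sum_congr rfl this]
    simp
  have hb : ∀ j, ‖P (t j)‖ ≤ ∑ j, ‖g 0 (t j)‖ + K := by
    intro j
    have h1 : ‖g 0 (t j) - P (t j)‖ ≤ K := norm_sub_taylor_le (m + 1) g hg hcont (ht j)
    have h2 : ‖g 0 (t j)‖ ≤ ∑ j, ‖g 0 (t j)‖ :=
      Finset.single_le_sum (f := fun j => ‖g 0 (t j)‖) (fun _ _ => norm_nonneg _)
        (Finset.mem_univ j)
    have h3 := norm_sub_norm_le (P (t j)) (g 0 (t j))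
    rw [norm_sub_rev] at h3
    linarith
  rw [← hP, Finset.sum_mul]
  refine norm_sum_le_of_le _ fun j _ => ?_
  rw [norm_smul, Real.norm_eq_abs]
  gcongr
  exact hb j

end Taylor

/-- The weighted power `‖∇^k w‖^p min(1,d)^{-ap} d^s` of the `k`-th derivative. -/
def weightedPow {N : ℕ} {F : Type*} [NormedAddCommGroup F] [NormedSpace ℝ F]
    (Ω : Set (Euc N)) (p s : ℝ) (k a : ℕ) (w : Euc N → F) (x : Euc N) : ℝ :=
  ‖iteratedFDeriv ℝ k w x‖ ^ p * (truncDist Ω x ^ (-(a : ℝ) * p) * dw Ω x ^ s)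

section Interpolation

variable {N : ℕ} {Ω : Set (Euc N)} {p s : ℝ}
  {F : Type*} [NormedAddCommGroup F] [NormedSpace ℝ F]

lemma weight_nonneg (a : ℝ) (x : Euc N) : 0 ≤ truncDist Ω x ^ a * dw Ω x ^ s :=
  mul_nonneg (Real.rpow_nonneg (truncDist_nonneg x) _) (Real.rpow_nonneg Metric.infDist_nonneg _)

lemma weightedPow_nonneg (k a : ℕ) (w : Euc N → F) (x : Euc N) :
    0 ≤ weightedPow Ω p s k a w x :=
  mul_nonneg (Real.rpow_nonneg (norm_nonneg _) _) (weight_nonneg _ x)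

lemma continuousOn_weight (hΩ : IsOpen Ω) (hc : Ωᶜ.Nonempty) (a s : ℝ) :
    ContinuousOn (fun x => truncDist Ω x ^ a * dw Ω x ^ s) Ω :=
  (continuous_truncDist.continuousOn.rpow_const fun _ hx =>
    Or.inl (truncDist_pos hΩ hc hx).ne').mul
    (continuous_dw.continuousOn.rpow_const fun _ hx => Or.inl (dw_pos hΩ hc hx).ne')

lemma contDiffAt_of_smoothOn (hΩ : IsOpen Ω) {w : Euc N → F}
    (hw : ContDiffOn ℝ (⊤ : ℕ∞) w Ω) {x : Euc N} (hx : x ∈ Ω) :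
    ContDiffAt ℝ (⊤ : ℕ∞) w x :=
  hw.contDiffAt (hΩ.mem_nhds hx)

lemma continuousOn_norm_iteratedFDeriv (hΩ : IsOpen Ω) {w : Euc N → F}
    (hw : ContDiffOn ℝ (⊤ : ℕ∞) w Ω) (k : ℕ) :
    ContinuousOn (fun x => ‖iteratedFDeriv ℝ k w x‖) Ω := fun _ hx =>
  ((contDiffAt_of_smoothOn hΩ hw hx).continuousAt_iteratedFDeriv
    (mod_cast le_top)).norm.continuousWithinAt

lemma continuousOn_weightedPow (hΩ : IsOpen Ω) (hc : Ωᶜ.Nonempty) (hp : 1 ≤ p)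
    {w : Euc N → F} (hw : ContDiffOn ℝ (⊤ : ℕ∞) w Ω) (k a : ℕ) :
    ContinuousOn (weightedPow Ω p s k a w) Ω :=
  ((continuousOn_norm_iteratedFDeriv hΩ hw k).rpow_const fun _ _ =>
    Or.inr (by linarith)).mul (continuousOn_weight hΩ hc _ _)

lemma rpow_le_two_rpow_mul {a b : ℝ} (ha : 0 < a) (hb : 0 < b) (h1 : a ≤ 2 * b)
    (h2 : b ≤ 2 * a) (s : ℝ) : a ^ s ≤ 2 ^ |s| * b ^ s := by
  rcases le_total 0 s with hs | hs
  · rw [abs_of_nonneg hs, ← Real.mul_rpow zero_le_two hb.le]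
    exact Real.rpow_le_rpow ha.le h1 hs
  · have h : (2 * a) ^ s ≤ b ^ s := Real.rpow_le_rpow_of_nonpos hb h2 hs
    rw [Real.mul_rpow zero_le_two ha.le] at h
    rw [abs_of_nonpos hs, Real.rpow_neg zero_le_two, ← div_eq_inv_mul,
      le_div_iff₀ (by positivity), mul_comm]
    exact h

lemma weight_le_shift (hΩ : IsOpen Ω) (hc : Ωᶜ.Nonempty) (a s : ℝ) {e : Euc N}
    (he : ‖e‖ ≤ 1) {σ : ℝ} (hσ : σ ∈ Set.Icc (0 : ℝ) 1) {x : Euc N} (hx : x ∈ Ω) :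
    truncDist Ω x ^ a * dw Ω x ^ s ≤ 2 ^ (|a| + |s|) *
      (truncDist Ω (shift Ω e σ x) ^ a * dw Ω (shift Ω e σ x) ^ s) := by
  have hy := shift_mem hΩ hc he hσ hx
  have h1 := rpow_le_two_rpow_mul (truncDist_pos hΩ hc hx) (truncDist_pos hΩ hc hy)
    (truncDist_shift_bounds he hσ x).1 (truncDist_shift_bounds he hσ x).2 a
  have h2 := rpow_le_two_rpow_mul (dw_pos hΩ hc hx) (dw_pos hΩ hc hy)
    (dw_shift_bounds he hσ x).1 (dw_shift_bounds he hσ x).2 s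
  rw [Real.rpow_add two_pos]
  have h3 := Real.rpow_nonneg (dw_pos hΩ hc hx).le s
  have h4 := Real.rpow_nonneg (truncDist_pos hΩ hc hy).le a
  calc _ ≤ _ := mul_le_mul h1 h2 h3 (by positivity)
    _ = _ := by ring

lemma continuousOn_comp_shift (hΩ : IsOpen Ω) (hc : Ωᶜ.Nonempty) {e : Euc N}
    (he : ‖e‖ ≤ 1) {x : Euc N} (hx : x ∈ Ω) {X : Type*} [TopologicalSpace X] {G : Euc N → X}
    (hG : ContinuousOn G Ω) : ContinuousOn (fun σ => G (shift Ω e σ x)) (Set.Icc 0 1) :=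
  hG.comp ((continuous_shift e).comp (Continuous.prodMk_right x)).continuousOn
    fun _ hσ => shift_mem hΩ hc he hσ hx

lemma hasDerivAt_iteratedFDeriv_shift (hΩ : IsOpen Ω) (hc : Ωᶜ.Nonempty)
    {w : Euc N → F} (hw : ContDiffOn ℝ (⊤ : ℕ∞) w Ω) {e : Euc N} (he : ‖e‖ ≤ 1)
    {x : Euc N} (hx : x ∈ Ω) (i : ℕ) {t : ℝ} (ht : t ∈ Set.Icc (0 : ℝ) 1) :
    HasDerivAt (fun t => (truncDist Ω x / 2) ^ i •
        iteratedFDeriv ℝ i w (shift Ω e t x) (fun _ => e))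
      ((truncDist Ω x / 2) ^ (i + 1) •
        iteratedFDeriv ℝ (i + 1) w (shift Ω e t x) (fun _ => e)) t := by
  have h1 : HasDerivAt (fun t => shift Ω e t x) ((truncDist Ω x / 2) • e) t := by
    unfold shift
    simpa using (((hasDerivAt_id t).mul_const (truncDist Ω x / 2)).smul_const e).const_add x
  have h2 := ((contDiffAt_of_smoothOn hΩ hw
    (shift_mem hΩ hc he ht hx)).differentiableAt_iteratedFDeriv
    (m := i) (by exact_mod_cast WithTop.coe_lt_top i)).hasFDerivAt
  have h3 := (ContinuousMultilinearMap.apply ℝ (fun _ : Fin i => Euc N) F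
    (fun _ => e)).hasFDerivAt.comp_hasDerivAt t (h2.comp_hasDerivAt t h1)
  convert h3.const_smul ((truncDist Ω x / 2) ^ i) using 1
  · rfl
  · rw [iteratedFDeriv_succ_apply_left]
    simp only [map_smul, smul_smul, pow_succ]
    rfl

lemma rpow_intervalIntegral_le (hp : 1 ≤ p) {f : ℝ → ℝ} (hf : ContinuousOn f (Set.Icc 0 1))
    (h0 : ∀ t, 0 ≤ f t) :
    (∫ t in (0 : ℝ)..1, f t) ^ p ≤ ∫ t in (0 : ℝ)..1, f t ^ p := by
  have hprob : IsProbabilityMeasure (volume.restrict (Set.Ioc (0 : ℝ) 1)) := ⟨by simp⟩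
  have hfp : ContinuousOn (fun t => f t ^ p) (Set.Icc 0 1) :=
    hf.rpow_const fun _ _ => Or.inr (by linarith)
  rw [intervalIntegral.integral_of_le zero_le_one, intervalIntegral.integral_of_le zero_le_one]
  exact (convexOn_rpow hp).map_integral_le
    (Real.continuous_rpow_const (by linarith)).continuousOn isClosed_Ici
    (Eventually.of_forall fun t => h0 t)
    (hf.integrableOn_Icc.mono_set Set.Ioc_subset_Icc_self)
    (hfp.integrableOn_Icc.mono_set Set.Ioc_subset_Icc_self)

lemma exists_norm_fderiv_le [CompleteSpace F] (hΩ : IsOpen Ω) (hc : Ωᶜ.Nonempty) (m : ℕ) :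
    ∃ (C : ℝ) (t : Fin (m + 2) → ℝ), 0 ≤ C ∧ (∀ j, t j ∈ Set.Icc (0 : ℝ) 1) ∧
    ∀ w : Euc N → F, ContDiffOn ℝ (⊤ : ℕ∞) w Ω → ∀ e : Euc N, ‖e‖ ≤ 1 → ∀ x ∈ Ω,
      truncDist Ω x / 2 * ‖fderiv ℝ w x e‖ ≤ C * (∑ j, ‖w (shift Ω e (t j) x)‖ +
        (truncDist Ω x / 2) ^ (m + 2) *
          ∫ σ in (0 : ℝ)..1, ‖iteratedFDeriv ℝ (m + 2) w (shift Ω e σ x)‖) := by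
  obtain ⟨C, t, hC, ht, H⟩ := exists_norm_deriv_le (F := F) m
  refine ⟨C, t, hC, ht, fun w hw e he x hx => ?_⟩
  have hh : 0 ≤ truncDist Ω x / 2 := by linarith [truncDist_nonneg (Ω := Ω) x]
  have hcm : ∀ k : ℕ, ContinuousOn (fun y => iteratedFDeriv ℝ k w y) Ω := fun k y hy =>
    ((contDiffAt_of_smoothOn hΩ hw hy).continuousAt_iteratedFDeriv
      (mod_cast le_top)).continuousWithinAt
  have h := H (fun i t => (truncDist Ω x / 2) ^ i •
        iteratedFDeriv ℝ i w (shift Ω e t x) (fun _ => e))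
    (fun i _ t ht => hasDerivAt_iteratedFDeriv_shift hΩ hc hw he hx i ht) (by
      refine ContinuousOn.const_smul ?_ _
      exact (ContinuousMultilinearMap.apply ℝ (fun _ : Fin (m + 2) => Euc N) F
        (fun _ => e)).continuous.comp_continuousOn
        (continuousOn_comp_shift hΩ hc he hx (hcm (m + 2))))
  have h0 : shift Ω e 0 x = x := by simp [shift]
  simp only [h0, pow_one, norm_smul, Real.norm_of_nonneg hh, pow_zero, one_smul,
    iteratedFDeriv_one_apply, iteratedFDeriv_zero_apply] at h
  refine h.trans ?_
  gcongr
  rw [← intervalIntegral.integral_const_mul]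
  have hcn := continuousOn_comp_shift hΩ hc he hx (hcm (m + 2))
  refine intervalIntegral.integral_mono_on zero_le_one ?_ ?_ fun σ hσ => ?_
  · refine ContinuousOn.intervalIntegrable_of_Icc zero_le_one (continuousOn_const.mul (ContinuousOn.norm ?_))
    exact (ContinuousMultilinearMap.apply ℝ (fun _ : Fin (m + 2) => Euc N) F
        (fun _ => e)).continuous.comp_continuousOn hcn
  · exact (continuousOn_const.mul hcn.norm).intervalIntegrable_of_Icc zero_le_one
  · rw [norm_pow, Real.norm_of_nonneg hh]
    gcongr
    refine (ContinuousMultilinearMap.le_opNorm _ _).trans ?_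
    refine mul_le_of_le_one_right (norm_nonneg _) ?_
    exact Finset.prod_le_one (fun _ _ => norm_nonneg _) fun _ _ => he

lemma exists_rpow_fderiv_le [CompleteSpace F] (hΩ : IsOpen Ω) (hc : Ωᶜ.Nonempty)
    (hp : 1 ≤ p) (s : ℝ) (m : ℕ) :
    ∃ (A : ℝ) (t : Fin (m + 2) → ℝ), (∀ j, t j ∈ Set.Icc (0 : ℝ) 1) ∧
    ∀ w : Euc N → F, ContDiffOn ℝ (⊤ : ℕ∞) w Ω → ∀ e : Euc N, ‖e‖ ≤ 1 → ∀ x ∈ Ω,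
      ‖fderiv ℝ w x e‖ ^ p * (truncDist Ω x ^ (-((m + 1 : ℕ) : ℝ) * p) * dw Ω x ^ s) ≤
        A * (∑ j, weightedPow Ω p s 0 (m + 2) w (shift Ω e (t j) x) +
          ∫ σ in (0 : ℝ)..1, weightedPow Ω p s (m + 2) 0 w (shift Ω e σ x)) := by
  obtain ⟨C, t, hC, ht, H⟩ := exists_norm_fderiv_le (F := F) hΩ hc m
  have hp0 : 0 ≤ p := by linarith
  set M : ℝ := ((m + 2 : ℕ) : ℝ)
  set B : ℝ := 2 ^ (|-M * p| + |s|)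
  set D : ℝ := (Fintype.card (Option (Fin (m + 2))) : ℝ) ^ (p - 1)
  have hD : 0 ≤ D := Real.rpow_nonneg (Nat.cast_nonneg _) _
  refine ⟨2 ^ p * (C ^ p * (D * B)), t, ht, fun w hw e he x hx => ?_⟩
  set r := truncDist Ω x
  have hr : 0 < r := truncDist_pos hΩ hc hx
  have hd : 0 < dw Ω x := dw_pos hΩ hc hx
  set W := r ^ (-M * p) * dw Ω x ^ s
  have hW : 0 ≤ W := weight_nonneg _ x
  set f := fun σ => ‖iteratedFDeriv ℝ (m + 2) w (shift Ω e σ x)‖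
  have hf : ContinuousOn f (Set.Icc 0 1) :=
    continuousOn_comp_shift hΩ hc he hx (continuousOn_norm_iteratedFDeriv hΩ hw (m + 2))
  set I := ∫ σ in (0 : ℝ)..1, f σ
  have hI : 0 ≤ I := intervalIntegral.integral_nonneg zero_le_one fun _ _ => norm_nonneg _
  set J := ∫ σ in (0 : ℝ)..1, weightedPow Ω p s (m + 2) 0 w (shift Ω e σ x)
  have hpow : (r / 2 * ‖fderiv ℝ w x e‖) ^ p ≤ C ^ p * (D *
      (∑ j, ‖w (shift Ω e (t j) x)‖ ^ p + ((r / 2) ^ (m + 2) * I) ^ p)) := by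
    refine (Real.rpow_le_rpow (by positivity) (H w hw e he x hx) hp0).trans ?_
    rw [Real.mul_rpow hC (by positivity)]
    gcongr
    set a : Option (Fin (m + 2)) → ℝ :=
      fun o => o.elim ((r / 2) ^ (m + 2) * I) fun j => ‖w (shift Ω e (t j) x)‖
    have h := Real.rpow_sum_le_const_mul_sum_rpow_of_nonneg Finset.univ hp (f := a)
      (fun o _ => by cases o <;> simp only [a, Option.elim] <;> positivity)
    simp only [Fintype.sum_option, a, Option.elim] at h
    rw [add_comm, add_comm (∑ j, _)]
    exact h
  have hnode : ∀ j, ‖w (shift Ω e (t j) x)‖ ^ p * W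
      ≤ B * weightedPow Ω p s 0 (m + 2) w (shift Ω e (t j) x) := by
    intro j
    rw [weightedPow, norm_iteratedFDeriv_zero, mul_left_comm B]
    refine mul_le_mul_of_nonneg_left ?_ (Real.rpow_nonneg (norm_nonneg _) _)
    exact weight_le_shift hΩ hc _ s he (ht j) hx
  have hrem : ((r / 2) ^ (m + 2) * I) ^ p * W ≤ B * J := by
    have h1 : ((r / 2) ^ (m + 2) * I) ^ p * W ≤ I ^ p * dw Ω x ^ s := by
      rw [Real.mul_rpow (by positivity) hI]
      have h2 : ((r / 2) ^ (m + 2)) ^ p * r ^ (-M * p) ≤ 1 := by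
        have h3 : ((r / 2) ^ (m + 2)) ^ p ≤ r ^ (M * p) := by
          rw [Real.rpow_mul hr.le, Real.rpow_natCast]
          gcongr
          linarith
        calc _ ≤ r ^ (M * p) * r ^ (-M * p) := by gcongr
          _ = 1 := by rw [← Real.rpow_add hr]; simp
      calc _ = (((r / 2) ^ (m + 2)) ^ p * r ^ (-M * p)) * (I ^ p * dw Ω x ^ s) := by
            simp only [W]; ring
        _ ≤ 1 * (I ^ p * dw Ω x ^ s) := by gcongr
        _ = _ := one_mul _
    refine h1.trans ?_
    have h4 : I ^ p ≤ ∫ σ in (0 : ℝ)..1, f σ ^ p :=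
      rpow_intervalIntegral_le hp hf fun _ => norm_nonneg _
    calc I ^ p * dw Ω x ^ s ≤ (∫ σ in (0 : ℝ)..1, f σ ^ p) * dw Ω x ^ s := by gcongr
      _ = ∫ σ in (0 : ℝ)..1, f σ ^ p * dw Ω x ^ s :=
          (intervalIntegral.integral_mul_const _ _).symm
      _ ≤ ∫ σ in (0 : ℝ)..1, B * weightedPow Ω p s (m + 2) 0 w (shift Ω e σ x) := by
          refine intervalIntegral.integral_mono_on zero_le_one ?_ ?_ fun σ hσ => ?_
          · refine ContinuousOn.intervalIntegrable_of_Icc zero_le_one ?_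
            exact (hf.rpow_const fun _ _ => Or.inr hp0).mul continuousOn_const
          · refine ContinuousOn.intervalIntegrable_of_Icc zero_le_one ?_
            exact continuousOn_const.mul (continuousOn_comp_shift hΩ hc he hx
              (continuousOn_weightedPow hΩ hc hp hw _ _))
          · rw [weightedPow, mul_left_comm]
            refine mul_le_mul_of_nonneg_left ?_ (Real.rpow_nonneg (norm_nonneg _) _)
            have h5 := weight_le_shift hΩ hc 0 s he hσ hx
            simp only [Real.rpow_zero, one_mul, abs_zero, zero_add] at h5
            simp only [Nat.cast_zero, neg_zero, zero_mul, Real.rpow_zero, one_mul]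
            refine h5.trans ?_
            refine mul_le_mul_of_nonneg_right ?_ (Real.rpow_nonneg Metric.infDist_nonneg _)
            exact Real.rpow_le_rpow_of_exponent_le one_le_two
              (by linarith [abs_nonneg (-M * p)])
      _ = B * J := intervalIntegral.integral_const_mul _ _
  have hlhs : ‖fderiv ℝ w x e‖ ^ p * (r ^ (-((m + 1 : ℕ) : ℝ) * p) * dw Ω x ^ s)
      = 2 ^ p * ((r / 2 * ‖fderiv ℝ w x e‖) ^ p * W) := by
    have h6 : r ^ (-((m + 1 : ℕ) : ℝ) * p) = r ^ p * r ^ (-M * p) := by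
      rw [← Real.rpow_add hr]
      congr 1
      simp only [M]
      push_cast
      ring
    have h7 : (2 : ℝ) ^ p ≠ 0 := by positivity
    rw [Real.mul_rpow (by positivity) (norm_nonneg _), Real.div_rpow hr.le zero_le_two, h6]
    simp only [W]
    field_simp
  rw [hlhs]
  calc _ ≤ 2 ^ p * (C ^ p * (D *
      (∑ j, ‖w (shift Ω e (t j) x)‖ ^ p + ((r / 2) ^ (m + 2) * I) ^ p)) * W) := by gcongr
    _ = 2 ^ p * (C ^ p * (D * (∑ j, ‖w (shift Ω e (t j) x)‖ ^ p * W
          + ((r / 2) ^ (m + 2) * I) ^ p * W))) := by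
        rw [← Finset.sum_mul]; ring
    _ ≤ 2 ^ p * (C ^ p * (D * (∑ j, B * weightedPow Ω p s 0 (m + 2) w (shift Ω e (t j) x)
          + B * J))) := by
        have := Finset.sum_le_sum fun j (_ : j ∈ Finset.univ) => hnode j
        gcongr
    _ = _ := by rw [← Finset.mul_sum]; ring

lemma norm_le_sum_apply_basis (L : Euc N →L[ℝ] F) :
    ‖L‖ ≤ ∑ i, ‖L (EuclideanSpace.basisFun (Fin N) ℝ i)‖ := by
  refine L.opNorm_le_bound (Finset.sum_nonneg fun _ _ => norm_nonneg _) fun v => ?_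
  conv_lhs => rw [← (EuclideanSpace.basisFun (Fin N) ℝ).sum_repr v]
  rw [map_sum, Finset.sum_mul]
  refine norm_sum_le_of_le _ fun i _ => ?_
  rw [map_smul, norm_smul, mul_comm]
  gcongr
  simpa using PiLp.norm_apply_le v i

lemma integrableOn_weightedPow_one [CompleteSpace F] (hΩ : IsOpen Ω) (hc : Ωᶜ.Nonempty)
    (hp : 1 ≤ p) (m : ℕ) {w : Euc N → F} (hw : ContDiffOn ℝ (⊤ : ℕ∞) w Ω)
    (h0 : IntegrableOn (weightedPow Ω p s 0 (m + 1) w) Ω)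
    (hm : IntegrableOn (weightedPow Ω p s (m + 1) 0 w) Ω) :
    IntegrableOn (weightedPow Ω p s 1 m w) Ω := by
  rcases m with _ | m
  · exact hm
  obtain ⟨A, t, ht, H⟩ := exists_rpow_fderiv_le (F := F) hΩ hc hp s m
  set b := EuclideanSpace.basisFun (Fin N) ℝ
  have hb : ∀ i, ‖b i‖ ≤ 1 := fun i => by simp [b]
  set D : ℝ := (Fintype.card (Fin N) : ℝ) ^ (p - 1)
  have hD : 0 ≤ D := Real.rpow_nonneg (Nat.cast_nonneg _) _
  have hint : IntegrableOn (fun x => D * ∑ i,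
      A * (∑ j, weightedPow Ω p s 0 (m + 2) w (shift Ω (b i) (t j) x) +
          ∫ σ in (0 : ℝ)..1, weightedPow Ω p s (m + 2) 0 w (shift Ω (b i) σ x))) Ω := by
    refine Integrable.const_mul (integrable_finsetSum _ fun i _ => Integrable.const_mul ?_ _) _
    refine Integrable.add (integrable_finsetSum _ fun j _ => ?_) ?_
    · exact integrableOn_comp_shift hΩ hc (hb i) (ht j) h0
    · exact integrableOn_integral_comp_shift hΩ hc (hb i) hm
  refine hint.mono' ((continuousOn_weightedPow hΩ hc hp hw 1 (m + 1)).aestronglyMeasurable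
    hΩ.measurableSet) ?_
  filter_upwards [ae_restrict_mem hΩ.measurableSet] with x hx
  rw [Real.norm_of_nonneg (weightedPow_nonneg _ _ _ _)]
  have h1 : ‖fderiv ℝ w x‖ ^ p ≤ D * ∑ i, ‖fderiv ℝ w x (b i)‖ ^ p :=
    (Real.rpow_le_rpow (norm_nonneg _) (norm_le_sum_apply_basis _) (by linarith)).trans
      (Real.rpow_sum_le_const_mul_sum_rpow_of_nonneg Finset.univ hp fun _ _ => norm_nonneg _)
  rw [weightedPow, norm_iteratedFDeriv_one]
  calc _ ≤ (D * ∑ i, ‖fderiv ℝ w x (b i)‖ ^ p) *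
        (truncDist Ω x ^ (-((m + 1 : ℕ) : ℝ) * p) * dw Ω x ^ s) :=
        mul_le_mul_of_nonneg_right h1 (weight_nonneg _ x)
    _ ≤ _ := by
        rw [mul_assoc, Finset.sum_mul]
        refine mul_le_mul_of_nonneg_left (Finset.sum_le_sum fun i _ => ?_) hD
        exact H w hw (b i) (hb i) x hx

end Interpolation

theorem integrableOn_weightedPow_of_le {N : ℕ} {Ω : Set (Euc N)} (hΩ : IsOpen Ω)
    (hc : Ωᶜ.Nonempty) {p s : ℝ} (hp : 1 ≤ p) {m k a : ℕ} (hk : k + a = m)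
    {F : Type} [NormedAddCommGroup F] [NormedSpace ℝ F] [CompleteSpace F]
    {w : Euc N → F} (hw : ContDiffOn ℝ (⊤ : ℕ∞) w Ω)
    (h0 : IntegrableOn (weightedPow Ω p s 0 m w) Ω)
    (hm : IntegrableOn (weightedPow Ω p s m 0 w) Ω) :
    IntegrableOn (weightedPow Ω p s k a w) Ω := by
  induction k generalizing F m with
  | zero =>
    obtain rfl : a = m := by omega
    exact h0
  | succ k ih =>
    obtain ⟨m, rfl⟩ : ∃ m', m = m' + 1 := ⟨k + a, by omega⟩
    have hpow : ∀ i b, weightedPow Ω p s (i + 1) b w = weightedPow Ω p s i b (fderiv ℝ w) := by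
      intro i b
      ext x
      rw [weightedPow, weightedPow, norm_iteratedFDeriv_fderiv]
    have h1 := integrableOn_weightedPow_one hΩ hc hp m hw h0 hm
    rw [hpow] at h1 hm ⊢
    exact ih (by omega) (hw.fderiv_of_isOpen hΩ (by simp)) h1 hm

section Cutoff

variable {N : ℕ} {Ω : Set (Euc N)}

open scoped Convolution
open ContinuousLinearMap (lsmul)

lemma exists_bound_iteratedFDeriv_convolution (i : ℕ) {F : Type} [NormedAddCommGroup F]
    [NormedSpace ℝ F] [CompleteSpace F] {g : Euc N → F} (hg : ContDiff ℝ (⊤ : ℕ∞) g)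
    (hgc : HasCompactSupport g) :
    ∃ C, ∀ f : Euc N → ℝ, LocallyIntegrable f volume → (∀ x, ‖f x‖ ≤ 1) →
      ∀ x, ‖iteratedFDeriv ℝ i (f ⋆[lsmul ℝ ℝ, volume] g) x‖ ≤ C := by
  induction i generalizing F with
  | zero =>
    refine ⟨∫ t, ‖g t‖, fun f _ hf x => ?_⟩
    rw [norm_iteratedFDeriv_zero, convolution_def]
    have hint : Integrable (fun t => ‖g t‖) :=
      (hg.continuous.integrable_of_hasCompactSupport hgc).norm
    rw [← integral_sub_left_eq_self (fun t => ‖g t‖) volume x]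
    refine norm_integral_le_of_norm_le (hint.comp_sub_left x) (Eventually.of_forall fun t => ?_)
    rw [ContinuousLinearMap.lsmul_apply, norm_smul]
    exact mul_le_of_le_one_left (norm_nonneg _) (hf t)
  | succ i ih =>
    obtain ⟨C, hC⟩ := ih (g := fderiv ℝ g) (hg.fderiv_right (by simp)) (hgc.fderiv ℝ)
    refine ⟨C, fun f hfl hf x => ?_⟩
    have hfd : fderiv ℝ (f ⋆[lsmul ℝ ℝ, volume] g)
        = f ⋆[lsmul ℝ ℝ, volume] fderiv ℝ g := by
      ext1 y
      rw [(hgc.hasFDerivAt_convolution_right (lsmul ℝ ℝ) hfl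
        (hg.of_le (by exact_mod_cast le_top)) y).fderiv]
      rfl
    rw [← norm_iteratedFDeriv_fderiv, hfd]
    exact hC f hfl hf x

lemma exists_smoothed_indicator (N : ℕ) : ∃ C : ℕ → ℝ, ∀ A : Set (Euc N), MeasurableSet A →
    ∃ χ : Euc N → ℝ, ContDiff ℝ (⊤ : ℕ∞) χ ∧ (∀ i x, ‖iteratedFDeriv ℝ i χ x‖ ≤ C i) ∧
      (∀ x, Metric.ball x 1 ⊆ A → χ x = 1) ∧ (∀ x, Disjoint (Metric.ball x 1) A → χ x = 0) := by
  let φ : ContDiffBump (0 : Euc N) := ⟨1 / 2, 1, by norm_num, by norm_num⟩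
  set η : Euc N → ℝ := φ.normed volume
  have hη : ContDiff ℝ (⊤ : ℕ∞) η := φ.contDiff_normed
  have hηc : HasCompactSupport η := φ.hasCompactSupport_normed
  have hη0 : ∀ x t : Euc N, t ∉ Metric.ball x 1 → η (x - t) = 0 := by
    intro x t ht
    rw [← Function.notMem_support, φ.support_normed_eq]
    simpa [φ, dist_eq_norm, norm_sub_rev] using ht
  choose C hC using fun i => exists_bound_iteratedFDeriv_convolution i hη hηc
  refine ⟨C, fun A hA => ?_⟩
  set f : Euc N → ℝ := A.indicator fun _ => 1
  have hfl : LocallyIntegrable f volume :=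
    (locallyIntegrable_const (1 : ℝ)).indicator hA
  have hf : ∀ x, ‖f x‖ ≤ 1 := fun x =>
    (norm_indicator_le_norm_self (fun _ => (1 : ℝ)) x).trans (by simp)
  refine ⟨f ⋆[lsmul ℝ ℝ, volume] η, hηc.contDiff_convolution_right _ hfl hη,
    fun i x => hC i f hfl hf x, fun x hx => ?_, fun x hx => ?_⟩
  · rw [convolution_def]
    calc _ = ∫ t, η (x - t) := by
          refine integral_congr_ae (Eventually.of_forall fun t => ?_)
          by_cases ht : t ∈ Metric.ball x 1
          · simp [f, hx ht]
          · simp [hη0 x t ht]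
      _ = 1 := by rw [integral_sub_left_eq_self η volume x]; exact φ.integral_normed
  · rw [convolution_def]
    refine integral_eq_zero_of_ae (Eventually.of_forall fun t => ?_)
    by_cases ht : t ∈ Metric.ball x 1
    · simp [f, Set.disjoint_left.1 hx ht]
    · simp [hη0 x t ht]

lemma exists_boundary_cutoff (hΩ : IsOpen Ω) (hc : Ωᶜ.Nonempty) : ∃ C : ℕ → ℝ,
    (∀ i, 0 ≤ C i) ∧ ∀ n : ℝ, 0 < n →
    ∃ χ : Euc N → ℝ, ContDiff ℝ (⊤ : ℕ∞) χ ∧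
      (∀ i, ∀ x ∈ Ω, ‖iteratedFDeriv ℝ i χ x‖ ≤ C i * (3 / truncDist Ω x) ^ i) ∧
      (∀ x, 3 / n ≤ dw Ω x → χ x = 1) ∧ (∀ x, dw Ω x < 1 / n → χ x = 0) := by
  obtain ⟨C, hC⟩ := exists_smoothed_indicator N
  have hC0 : ∀ i, 0 ≤ C i := fun i => by
    obtain ⟨χ, _, hχ, _⟩ := hC ∅ MeasurableSet.empty
    exact (norm_nonneg _).trans (hχ i 0)
  refine ⟨C, hC0, fun n hn => ?_⟩
  obtain ⟨χ, hχ, hχb, hχ1, hχ0⟩ := hC {y | 2 / n ≤ dw Ω (n⁻¹ • y)}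
    (measurableSet_le measurable_const
      (continuous_dw.measurable.comp (measurable_const_smul n⁻¹)))
  have hdist : ∀ x y : Euc N, y ∈ Metric.ball (n • x) 1 → dist (n⁻¹ • y) x < 1 / n := by
    intro x y hy
    rw [Metric.mem_ball, dist_eq_norm] at hy
    have : n⁻¹ • y - x = n⁻¹ • (y - n • x) := by
      rw [smul_sub, inv_smul_smul₀ hn.ne']
    rw [dist_eq_norm, this, norm_smul, norm_inv, Real.norm_of_nonneg hn.le, one_div]
    exact mul_lt_of_lt_one_right (inv_pos.2 hn) hy
  have h1 : ∀ x, 3 / n ≤ dw Ω x → χ (n • x) = 1 := by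
    intro x hx
    refine hχ1 _ fun y hy => ?_
    have h2 := dw_le_add (Ω := Ω) x (n⁻¹ • y)
    have h3 := hdist x y hy
    rw [dist_comm] at h3
    have h4 : 3 / n = 2 / n + 1 / n := by ring
    simp only [Set.mem_ofPred_eq]
    linarith
  refine ⟨fun x => χ (n • x), hχ.comp (contDiff_const_smul n), fun i x hx => ?_, h1,
    fun x hx => ?_⟩
  · have hr := truncDist_pos hΩ hc hx
    rcases Nat.eq_zero_or_pos i with rfl | hi
    · simpa using hχb 0 (n • x)
    rcases lt_or_ge (3 / n) (dw Ω x) with h | h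
    · have hev : (fun x => χ (n • x)) =ᶠ[nhds x] fun _ => (1 : ℝ) := by
        filter_upwards [continuous_dw.continuousAt.eventually (lt_mem_nhds h)] with y hy
        exact h1 y hy.le
      rw [hev.iteratedFDeriv ℝ i |>.eq_of_nhds, iteratedFDeriv_const_of_ne hi.ne']
      simp only [Pi.zero_apply, norm_zero]
      have := hC0 i
      positivity
    · rw [iteratedFDeriv_comp_const_smul n
        (hχ.of_le (by exact_mod_cast le_top) : ContDiff ℝ (i : ℕ∞) χ), norm_smul, norm_pow,
        Real.norm_of_nonneg hn.le, mul_comm]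
      have h5 : n ≤ 3 / truncDist Ω x := by
        rw [le_div_iff₀ hr]
        rw [le_div_iff₀ hn] at h
        have : truncDist Ω x ≤ dw Ω x := min_le_right _ _
        nlinarith
      have := hχb i (n • x)
      gcongr
      exact hC0 i
  · refine hχ0 _ (Set.disjoint_left.2 fun y hy hyA => ?_)
    have h2 := dw_le_add (Ω := Ω) (n⁻¹ • y) x
    have h3 := hdist x y hy
    have h4 : 2 / n = 1 / n + 1 / n := by ring
    simp only [Set.mem_ofPred_eq] at hyA
    linarith

theorem exists_cutoff (hΩ : IsOpen Ω) (hc : Ωᶜ.Nonempty) : ∃ C : ℕ → ℝ,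
    ∀ n : ℝ, 0 < n → ∃ ζ : Euc N → ℝ, IsTestFun Ω ζ ∧
      (∀ i, ∀ x ∈ Ω, ‖iteratedFDeriv ℝ i ζ x‖ ≤ C i * (truncDist Ω x)⁻¹ ^ i) ∧
      (∀ x, 3 / n ≤ dw Ω x → ‖x‖ ≤ n → ζ x = 1) := by
  obtain ⟨C₁, hC₁, H₁⟩ := exists_boundary_cutoff hΩ hc
  obtain ⟨C₂, H₂⟩ := exists_smoothed_indicator N
  refine ⟨fun i => (∑ j ∈ Finset.range (i + 1), (i.choose j : ℝ) * C₁ j * C₂ (i - j)) * 3 ^ i,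
    fun n hn => ?_⟩
  obtain ⟨χ, hχ, hχb, hχ1, hχ0⟩ := H₁ n hn
  obtain ⟨ψ, hψ, hψb, hψ1, hψ0⟩ := H₂ (Metric.ball 0 (n + 1)) measurableSet_ball
  have hsupp : tsupport (fun x => χ x * ψ x)
      ⊆ {x | 1 / n ≤ dw Ω x} ∩ Metric.closedBall 0 (n + 2) := by
    refine closure_minimal (fun x hx => ?_)
      ((isClosed_le continuous_const continuous_dw).inter Metric.isClosed_closedBall)
    rw [Function.mem_support] at hx
    refine ⟨?_, ?_⟩
    · by_contra h
      exact hx (by rw [hχ0 x (not_le.1 h), zero_mul])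
    · by_contra h
      refine hx ?_
      rw [hψ0 x, mul_zero]
      refine Metric.ball_disjoint_ball ?_
      rw [Metric.mem_closedBall, not_le] at h
      linarith
  refine ⟨fun x => χ x * ψ x, ⟨hχ.mul hψ, ?_, ?_⟩, fun i x hx => ?_, fun x hx hxn => ?_⟩
  · exact (isCompact_closedBall (0 : Euc N) (n + 2)).of_isClosed_subset (isClosed_tsupport _)
      (hsupp.trans Set.inter_subset_right)
  · intro x hx
    exact mem_of_dw_pos (lt_of_lt_of_le (by positivity) (hsupp hx).1)
  · have hr := truncDist_pos hΩ hc hx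
    have hr1 : truncDist Ω x ≤ 1 := min_le_left _ _
    refine (norm_iteratedFDeriv_mul_le hχ hψ x (n := i) (by exact_mod_cast le_top)).trans ?_
    rw [mul_assoc, ← mul_pow, ← div_eq_mul_inv, Finset.sum_mul]
    refine Finset.sum_le_sum fun j hj => ?_
    have hji : j ≤ i := Nat.lt_succ_iff.1 (Finset.mem_range.1 hj)
    have h3 : 1 ≤ 3 / truncDist Ω x := by
      rw [le_div_iff₀ hr]
      linarith
    have hC₂ : 0 ≤ C₂ (i - j) := (norm_nonneg _).trans (hψb (i - j) x)
    have h4 := hχb j x hx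
    have h5 := hψb (i - j) x
    have h6 := hC₁ j
    calc _ ≤ (i.choose j : ℝ) * (C₁ j * (3 / truncDist Ω x) ^ i) * C₂ (i - j) := by
          gcongr
          refine h4.trans ?_
          gcongr
      _ = _ := by ring
  · show χ x * ψ x = 1
    rw [hχ1 x hx, hψ1 x, one_mul]
    refine Metric.ball_subset_ball' ?_
    rw [dist_zero_right]
    linarith

end Cutoff

section Approximation

variable {N : ℕ} {Ω : Set (Euc N)} {p s : ℝ} {m : ℕ} {u : Euc N → ℝ}

lemma IsTestFun.smooth_mul (hΩ : IsOpen Ω) {ζ : Euc N → ℝ} (hζ : IsTestFun Ω ζ)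
    (hu : ContDiffOn ℝ (⊤ : ℕ∞) u Ω) : IsTestFun Ω (fun x => ζ x * u x) := by
  have hsub : tsupport (fun x => ζ x * u x) ⊆ tsupport ζ := tsupport_mul_subset_left
  refine ⟨contDiff_iff_contDiffAt.2 fun x => ?_,
    hζ.2.1.of_isClosed_subset (isClosed_tsupport _) hsub, hsub.trans hζ.2.2⟩
  by_cases hx : x ∈ tsupport ζ
  · exact hζ.1.contDiffAt.mul (contDiffAt_of_smoothOn hΩ hu (hζ.2.2 hx))
  · have : (fun x => ζ x * u x) =ᶠ[nhds x] fun _ => 0 := by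
      filter_upwards [notMem_tsupport_iff_eventuallyEq.1 hx] with y hy
      simp [hy]
    exact contDiffAt_const.congr_of_eventuallyEq this

lemma exists_weighted_leibniz (hΩ : IsOpen Ω) (hc : Ωᶜ.Nonempty) (hp : 1 ≤ p) (s : ℝ) (m : ℕ)
    (hu : ContDiffOn ℝ (⊤ : ℕ∞) u Ω) (C : ℕ → ℝ) :
    ∃ D : ℝ, ∀ η : Euc N → ℝ, ContDiff ℝ (⊤ : ℕ∞) η →
      (∀ i, ∀ x ∈ Ω, ‖iteratedFDeriv ℝ i η x‖ ≤ C i * (truncDist Ω x)⁻¹ ^ i) →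
      ∀ k ≤ m, ∀ x ∈ Ω, ‖iteratedFDeriv ℝ k (fun y => η y * u y) x‖ ^ p * dw Ω x ^ s ≤
        D * ∑ l ∈ Finset.range (m + 1), weightedPow Ω p s l (m - l) u x := by
  have hp0 : 0 ≤ p := by linarith
  set K : ℝ := ∑ k ∈ Finset.range (m + 1), ∑ i ∈ Finset.range (k + 1), (k.choose i : ℝ) * |C i|
  have hK : 0 ≤ K := by positivity
  refine ⟨K ^ p * ((m + 1 : ℕ) : ℝ) ^ (p - 1), fun η hη hηb k hk x hx => ?_⟩
  have hr := truncDist_pos hΩ hc hx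
  have hr1 : 1 ≤ (truncDist Ω x)⁻¹ := (one_le_inv₀ hr).2 (min_le_left _ _)
  set S : ℝ := ∑ l ∈ Finset.range (m + 1), (truncDist Ω x)⁻¹ ^ (m - l) * ‖iteratedFDeriv ℝ l u x‖
  have hS : 0 ≤ S := by positivity
  have hterm : ∀ i ∈ Finset.range (k + 1),
      (truncDist Ω x)⁻¹ ^ i * ‖iteratedFDeriv ℝ (k - i) u x‖ ≤ S := by
    intro i hi
    have hik : i ≤ k := Nat.lt_succ_iff.1 (Finset.mem_range.1 hi)
    refine le_trans ?_ (Finset.single_le_sum (f := fun l =>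
      (truncDist Ω x)⁻¹ ^ (m - l) * ‖iteratedFDeriv ℝ l u x‖) (fun _ _ => by positivity)
      (Finset.mem_range.2 (by omega : k - i < m + 1)))
    have : (truncDist Ω x)⁻¹ ^ i ≤ (truncDist Ω x)⁻¹ ^ (m - (k - i)) :=
      pow_le_pow_right₀ hr1 (by omega)
    gcongr
  have hbound : ‖iteratedFDeriv ℝ k (fun y => η y * u y) x‖ ≤ K * S := by
    have h := norm_iteratedFDerivWithin_mul_le (n := k) hη.contDiffOn hu hΩ.uniqueDiffOn hx
      (by exact_mod_cast le_top)
    simp only [iteratedFDerivWithin_of_isOpen _ hΩ hx] at h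
    calc _ ≤ _ := h
      _ ≤ ∑ i ∈ Finset.range (k + 1), (k.choose i : ℝ) * |C i| * S := by
          refine Finset.sum_le_sum fun i hi => ?_
          have h1 : ‖iteratedFDeriv ℝ i η x‖ ≤ |C i| * (truncDist Ω x)⁻¹ ^ i :=
            (hηb i x hx).trans (by gcongr; exact le_abs_self _)
          calc _ ≤ (k.choose i : ℝ) * (|C i| * (truncDist Ω x)⁻¹ ^ i) *
                ‖iteratedFDeriv ℝ (k - i) u x‖ := by gcongr
            _ = (k.choose i : ℝ) * |C i| *
                ((truncDist Ω x)⁻¹ ^ i * ‖iteratedFDeriv ℝ (k - i) u x‖) := by ring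
            _ ≤ _ := by gcongr; exact hterm i hi
      _ ≤ K * S := by
          rw [← Finset.sum_mul]
          gcongr
          exact Finset.single_le_sum (f := fun k => ∑ i ∈ Finset.range (k + 1),
            (k.choose i : ℝ) * |C i|) (fun _ _ => by positivity)
            (Finset.mem_range.2 (by omega : k < m + 1))
  have hSp : S ^ p ≤ ((m + 1 : ℕ) : ℝ) ^ (p - 1) * ∑ l ∈ Finset.range (m + 1),
      ((truncDist Ω x)⁻¹ ^ (m - l) * ‖iteratedFDeriv ℝ l u x‖) ^ p := by
    have h := Real.rpow_sum_le_const_mul_sum_rpow_of_nonneg (Finset.range (m + 1)) hp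
      (f := fun l => (truncDist Ω x)⁻¹ ^ (m - l) * ‖iteratedFDeriv ℝ l u x‖)
      (fun _ _ => by positivity)
    rw [Finset.card_range] at h
    exact h
  have hd := Real.rpow_nonneg (dw_pos hΩ hc hx).le s
  calc _ ≤ (K * S) ^ p * dw Ω x ^ s := by gcongr
    _ ≤ K ^ p * (((m + 1 : ℕ) : ℝ) ^ (p - 1) * ∑ l ∈ Finset.range (m + 1),
      ((truncDist Ω x)⁻¹ ^ (m - l) * ‖iteratedFDeriv ℝ l u x‖) ^ p) * dw Ω x ^ s := by
        rw [Real.mul_rpow hK hS]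
        gcongr
    _ = _ := by
        rw [← mul_assoc, mul_assoc _ _ (dw Ω x ^ s), Finset.sum_mul]
        congr 1
        refine Finset.sum_congr rfl fun l _ => ?_
        rw [weightedPow, Real.mul_rpow (by positivity) (norm_nonneg _), inv_pow,
          ← Real.rpow_natCast, ← Real.rpow_neg hr.le, ← Real.rpow_mul hr.le]
        ring

lemma memW0_of_not_integrableOn (hp : 0 < p)
    (h : ¬ IntegrableOn (fun x => |u x| ^ p * dw Ω x ^ s) Ω) : MemW0 Ω m p s u := by
  refine ⟨fun _ => 0, fun _ => ⟨contDiff_const, HasCompactSupport.zero, by simp [tsupport]⟩,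
    fun ε hε => ⟨0, fun _ _ _ _ => ?_⟩, ?_⟩
  · have : sobNorm Ω m p s ((0 : Euc N → ℝ) - 0) = 0 := by
      unfold sobNorm
      refine Finset.sum_eq_zero fun k _ => ?_
      have h0 : iteratedFDeriv ℝ k (0 : Euc N → ℝ) = 0 := iteratedFDeriv_fun_zero
      simp only [sub_zero, h0, Pi.zero_apply, norm_zero, Real.zero_rpow hp.ne', zero_mul,
        integral_zero]
      exact Real.zero_rpow (one_div_pos.2 hp).ne'
    exact this.trans_lt hε
  · simp only [Pi.zero_apply, zero_sub, abs_neg]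
    rw [integral_undef h]
    exact tendsto_const_nhds

lemma integrableOn_weightedPow_zero (hΩ : IsOpen Ω) (hc : Ωᶜ.Nonempty) (hp : 1 ≤ p)
    (hu : ContDiffOn ℝ (⊤ : ℕ∞) u Ω)
    (h1 : IntegrableOn (fun x => |u x| ^ p * dw Ω x ^ (-(m : ℝ) * p + s)) Ω volume)
    (h3 : IntegrableOn (fun x => |u x| ^ p * dw Ω x ^ s) Ω volume) :
    IntegrableOn (weightedPow Ω p s 0 m u) Ω := by
  refine (h1.add h3).mono' ((continuousOn_weightedPow hΩ hc hp hu 0 m).aestronglyMeasurable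
    hΩ.measurableSet) ?_
  filter_upwards [ae_restrict_mem hΩ.measurableSet] with x hx
  have hd := dw_pos hΩ hc hx
  rw [Real.norm_of_nonneg (weightedPow_nonneg _ _ _ _), weightedPow, norm_iteratedFDeriv_zero,
    Real.norm_eq_abs, Pi.add_apply, ← mul_add]
  gcongr
  rcases min_choice 1 (dw Ω x) with h | h <;> rw [truncDist, h]
  · rw [Real.one_rpow, one_mul]
    exact le_add_of_nonneg_left (Real.rpow_nonneg hd.le _)
  · rw [← Real.rpow_add hd]
    exact le_add_of_nonneg_right (Real.rpow_nonneg hd.le _)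

lemma memW0_of_integrableOn (hΩ : IsOpen Ω) (hc : Ωᶜ.Nonempty) (hp : 1 ≤ p)
    (hu : ContDiffOn ℝ (⊤ : ℕ∞) u Ω)
    (h1 : IntegrableOn (fun x => |u x| ^ p * dw Ω x ^ (-(m : ℝ) * p + s)) Ω volume)
    (h2 : IntegrableOn
      (fun x => ‖iteratedFDerivWithin ℝ m u Ω x‖ ^ p * dw Ω x ^ s) Ω volume)
    (h3 : IntegrableOn (fun x => |u x| ^ p * dw Ω x ^ s) Ω volume) :
    MemW0 Ω m p s u := by
  have hp0 : 0 < p := by linarith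
  have hint0 := integrableOn_weightedPow_zero hΩ hc hp hu h1 h3
  have hintm : IntegrableOn (weightedPow Ω p s m 0 u) Ω := by
    refine h2.congr_fun (fun x hx => ?_) hΩ.measurableSet
    simp [weightedPow, iteratedFDerivWithin_of_isOpen _ hΩ hx]
  set Q : Euc N → ℝ := fun x =>
    ∑ l ∈ Finset.range (m + 1), weightedPow Ω p s l (m - l) u x
  have hQ : IntegrableOn Q Ω := integrable_finsetSum _ fun l hl =>
    integrableOn_weightedPow_of_le hΩ hc hp
      (Nat.add_sub_of_le (Nat.lt_succ_iff.1 (Finset.mem_range.1 hl))) hu hint0 hintm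
  have hQ0 : ∀ x, 0 ≤ Q x := fun x => Finset.sum_nonneg fun _ _ => weightedPow_nonneg _ _ _ _
  obtain ⟨C, hC⟩ := exists_cutoff hΩ hc
  choose ζ hζ hζb hζ1 using fun n : ℕ => hC (n + 1 : ℝ) (by positivity)
  obtain ⟨D, hD⟩ := exists_weighted_leibniz hΩ hc hp s m hu (fun i => C i + C i)
  -- On the open sets `E J` exhausting `Ω`, all cutoffs of index at least `J` equal one.
  let E : ℕ → Set (Euc N) := fun J => {x | 3 / ((J : ℝ) + 1) < dw Ω x ∧ ‖x‖ < J + 1}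
  have hEo : ∀ J, IsOpen (E J) := fun J =>
    (isOpen_lt continuous_const continuous_dw).inter (isOpen_lt continuous_norm continuous_const)
  have hE : ∀ J, ∀ j ≥ J, ∀ x ∈ E J, ζ j x = 1 := by
    intro J j hj x hx
    have hJj : (J : ℝ) ≤ j := by exact_mod_cast hj
    refine hζ1 j x (le_trans ?_ hx.1.le) (by linarith [hx.2])
    gcongr
  have hEx : ∀ x ∈ Ω, ∀ᶠ J in atTop, x ∈ E J := by
    intro x hx
    have ht : Tendsto (fun J : ℕ => (J : ℝ) + 1) atTop atTop :=
      tendsto_atTop_add_const_right _ _ tendsto_natCast_atTop_atTop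
    filter_upwards [(ht.const_div_atTop 3).eventually (gt_mem_nhds (dw_pos hΩ hc hx)),
      ht.eventually (eventually_gt_atTop ‖x‖)] with J h4 h5
    exact ⟨h4, h5⟩
  set T : ℕ → ℝ := fun J => ∫ x in Ω, (E J)ᶜ.indicator (fun x => D * Q x) x
  have hTint : ∀ J, IntegrableOn ((E J)ᶜ.indicator (fun x => D * Q x)) Ω := fun J =>
    (hQ.const_mul D).indicator (hEo J).measurableSet.compl
  have hT : Tendsto T atTop (nhds 0) := by
    have h := tendsto_integral_of_dominated_convergence (μ := volume.restrict Ω)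
      (F := fun J => (E J)ᶜ.indicator (fun x => D * Q x)) (f := fun _ => 0)
      (fun x => ‖D * Q x‖) (fun J => (hTint J).aestronglyMeasurable) (hQ.const_mul D).norm
      (fun J => Eventually.of_forall fun x => norm_indicator_le_norm_self _ _) (by
        filter_upwards [ae_restrict_mem hΩ.measurableSet] with x hx
        refine tendsto_const_nhds.congr' ?_
        filter_upwards [hEx x hx] with J hJ
        simp [hJ])
    simpa using h
  refine ⟨fun j x => ζ j x * u x, fun j => (hζ j).smooth_mul hΩ hu, ?_, ?_⟩
  · have hsob : ∀ J, ∀ j ≥ J, ∀ k ≥ J, sobNorm Ω m p s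
        ((fun x => ζ j x * u x) - fun x => ζ k x * u x) ≤ (m + 1) * T J ^ (1 / p) := by
      intro J j hj k hk
      have hsub : ((fun x => ζ j x * u x) - fun x => ζ k x * u x)
          = fun x => (ζ j - ζ k) x * u x := by
        ext x
        simp [sub_mul]
      rw [hsub, sobNorm]
      have hterm : ∀ l ∈ Finset.range (m + 1),
          (∫ x in Ω, ‖iteratedFDeriv ℝ l (fun x => (ζ j - ζ k) x * u x) x‖ ^ p * dw Ω x ^ s)
            ^ (1 / p) ≤ T J ^ (1 / p) := by
        intro l hl
        have hpt : ∀ x, 0 ≤ ‖iteratedFDeriv ℝ l (fun x => (ζ j - ζ k) x * u x) x‖ ^ p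
            * dw Ω x ^ s := fun x => mul_nonneg (Real.rpow_nonneg (norm_nonneg _) _)
          (Real.rpow_nonneg Metric.infDist_nonneg _)
        refine Real.rpow_le_rpow (integral_nonneg hpt) ?_ (by positivity)
        refine integral_mono_of_nonneg (Eventually.of_forall hpt) (hTint J) ?_
        filter_upwards [ae_restrict_mem hΩ.measurableSet] with x hx
        by_cases hxE : x ∈ E J
        · have hev : (fun x => (ζ j - ζ k) x * u x) =ᶠ[nhds x] 0 := by
            filter_upwards [(hEo J).mem_nhds hxE] with y hy
            simp [hE J j hj y hy, hE J k hk y hy]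
          rw [hev.iteratedFDeriv ℝ l |>.eq_of_nhds]
          simp [hxE, Real.zero_rpow hp0.ne']
        · rw [Set.indicator_of_mem hxE]
          refine hD (ζ j - ζ k) ((hζ j).1.sub (hζ k).1) (fun i y hy => ?_) l
            (Nat.lt_succ_iff.1 (Finset.mem_range.1 hl)) x hx
          rw [iteratedFDeriv_sub_apply (((hζ j).1.of_le (by exact_mod_cast le_top)).contDiffAt)
            (((hζ k).1.of_le (by exact_mod_cast le_top)).contDiffAt), add_mul]
          exact (norm_sub_le _ _).trans (add_le_add (hζb j i y hy) (hζb k i y hy))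
      refine (Finset.sum_le_sum hterm).trans (le_of_eq ?_)
      simp
    have hlim : Tendsto (fun J => ((m : ℝ) + 1) * T J ^ (1 / p)) atTop (nhds 0) := by
      have h := (hT.rpow_const (p := 1 / p) (Or.inr (by positivity))).const_mul ((m : ℝ) + 1)
      rwa [Real.zero_rpow (one_div_pos.2 hp0).ne', mul_zero] at h
    intro ε hε
    obtain ⟨J, hJ⟩ := (hlim.eventually (gt_mem_nhds hε)).exists
    exact ⟨J, fun j hj k hk => (hsob J j hj k hk).trans_lt hJ⟩
  · have hcont : ContinuousOn (fun x => dw Ω x ^ s) Ω :=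
      continuous_dw.continuousOn.rpow_const fun _ hx => Or.inl (dw_pos hΩ hc hx).ne'
    have h := tendsto_integral_of_dominated_convergence (μ := volume.restrict Ω)
      (F := fun j x => |ζ j x * u x - u x| ^ p * dw Ω x ^ s) (f := fun _ => 0)
      (fun x => (C 0 + 1) ^ p * (|u x| ^ p * dw Ω x ^ s)) (fun j => by
        refine ContinuousOn.aestronglyMeasurable (ContinuousOn.mul ?_ hcont) hΩ.measurableSet
        refine ContinuousOn.rpow_const ?_ fun _ _ => Or.inr hp0.le
        exact (((hζ j).1.continuous.continuousOn.mul hu.continuousOn).sub hu.continuousOn).abs)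
      (h3.const_mul _) (fun j => by
        filter_upwards [ae_restrict_mem hΩ.measurableSet] with x hx
        have hd := Real.rpow_nonneg (dw_pos hΩ hc hx).le s
        have h4 : |ζ j x| ≤ C 0 := by simpa using hζb j 0 x hx
        have h5 : |ζ j x * u x - u x| ≤ (C 0 + 1) * |u x| := by
          have : ζ j x * u x - u x = (ζ j x - 1) * u x := by ring
          rw [this, abs_mul]
          gcongr
          exact (abs_sub _ _).trans (by rw [abs_one]; linarith)
        have h6 : 0 ≤ C 0 := (abs_nonneg _).trans h4
        rw [Real.norm_of_nonneg (by positivity), ← mul_assoc,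
          ← Real.mul_rpow (by positivity) (abs_nonneg _)]
        gcongr) (by
        filter_upwards [ae_restrict_mem hΩ.measurableSet] with x hx
        refine tendsto_const_nhds.congr' ?_
        obtain ⟨J, hJ⟩ := (hEx x hx).exists
        filter_upwards [eventually_ge_atTop J] with j hj
        simp [hE J j hj x hJ, Real.zero_rpow hp0.ne'])
    simpa using h

end Approximation

/-- **Theorem 3 (Wannebo, after Ancona)**: if `Ω ⊆ ℝ^N` is open with nonempty
complement, `m ≥ 1`, `p ≥ 1`, `s ∈ ℝ`, and `u` is smooth on `Ω` with
`∫_Ω |u|^p d^{-mp+s} < ∞` and `∫_Ω ‖∇^m u‖^p d^s < ∞`, then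
`u ∈ W_0^{m,p}(Ω, d^s)`. -/
theorem mem_W0_of_weighted_integrability {N : ℕ} (hN : 1 ≤ N) (Ω : Set (Euc N))
    (hΩ : IsOpen Ω) (hc : Ωᶜ.Nonempty) (m : ℕ) (hm : 1 ≤ m)
    (p : ℝ) (hp : 1 ≤ p) (s : ℝ) (u : Euc N → ℝ)
    (hu : ContDiffOn ℝ (⊤ : ℕ∞) u Ω)
    (h1 : IntegrableOn (fun x => |u x| ^ p * dw Ω x ^ (-(m : ℝ) * p + s)) Ω volume)
    (h2 : IntegrableOn
      (fun x => ‖iteratedFDerivWithin ℝ m u Ω x‖ ^ p * dw Ω x ^ s) Ω volume) :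
    MemW0 Ω m p s u := by
  by_cases h3 : IntegrableOn (fun x => |u x| ^ p * dw Ω x ^ s) Ω volume
  · exact memW0_of_integrableOn hΩ hc hp hu h1 h2 h3
  · exact memW0_of_not_integrableOn (by linarith) h3
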